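/- arXiv:math/0309372 — 2 statements merged into one kernel-verified Lean document; each statement's English description precedes it below -/
import Mathlib

section
/- Let κ be a nonzero complex number, l a positive integer, a, b ∈ {0,…,l}, and let t₁,…,t_l, z, μ, m₁, m₂ be complex numbers such that for every u: (t_u+m₁)/κ ∉ ℤ and (t_u−z+m₂)/κ ∉ ℤ, and for every pair u ≠ v: (t_u−t_v)/κ ∉ ℤ and (t_u−t_v−1)/κ ∉ ℤ. Then Φ_l(t,z,μ;m₁,m₂) · w_{l−a,a}(t,z;m₁,m₂) · W_{l−b,b}(t,z;m₁,m₂) = Ξ_l(t,z,μ;m₁,m₂) · p_{l−a,a}(t,z;m₂) · P_{l−b,b}(t,z;m₂). -/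
open Complex Real Finset

/-- Symmetrization: `Sym f(t₁,…,t_l) = Σ_{σ ∈ S_l} f(t_{σ(1)},…,t_{σ(l)})`. -/
noncomputable def SymSum {l : ℕ} (f : (Fin l → ℂ) → ℂ) (t : Fin l → ℂ) : ℂ :=
  ∑ σ : Equiv.Perm (Fin l), f (t ∘ σ)

/-- The q-master function `Φ_l(t,z,μ;m₁,m₂)`. -/
noncomputable def qMaster (κ : ℂ) {l : ℕ} (t : Fin l → ℂ) (z μ m₁ m₂ : ℂ) : ℂ :=
  Complex.exp (μ * (∑ u, t u) / κ) *
  (∏ u, (Complex.Gamma (t u / κ) * Complex.Gamma ((t u - z) / κ)) /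
      (Complex.Gamma ((t u + m₁) / κ) * Complex.Gamma ((t u - z + m₂) / κ))) *
  ∏ u, ∏ v ∈ Finset.Ioi u,
    Complex.Gamma ((t u - t v + 1) / κ) / Complex.Gamma ((t u - t v - 1) / κ)

/-- The rational weight function `w_{l−a,a}(t,z;m₁,m₂)` (indices `u = l−a+1,…,l` of the paper
correspond to the 0-based indices `u` with `l − a ≤ u`). -/
noncomputable def ratWeight {l : ℕ} (a : ℕ) (t : Fin l → ℂ) (z m₁ m₂ : ℂ) : ℂ :=
  (∏ u, ∏ v ∈ Finset.Ioi u, (t u - t v) / (t u - t v - 1)) *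
  (∏ u, (t u + m₁)⁻¹) *
  SymSum (fun s =>
    (∏ u ∈ Finset.univ.filter (fun u : Fin l => l - a ≤ (u : ℕ)), s u / (s u - z + m₂)) *
    ∏ u, ∏ v ∈ Finset.Ioi u, (s u - s v - 1) / (s u - s v)) t

/-- The trigonometric weight function `W_{l−b,b}(t,z;m₁,m₂)`. -/
noncomputable def trigWeight (κ : ℂ) {l : ℕ} (b : ℕ) (t : Fin l → ℂ) (z m₁ m₂ : ℂ) : ℂ :=
  (∏ u, ∏ v ∈ Finset.Ioi u,
      Complex.sin ((π : ℂ) * (t u - t v) / κ) / Complex.sin ((π : ℂ) * (t u - t v - 1) / κ)) *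
  (∏ u, Complex.exp (-(π : ℂ) * Complex.I * t u / κ) /
      Complex.sin ((π : ℂ) * (t u + m₁) / κ)) *
  SymSum (fun s =>
    (∏ u ∈ Finset.univ.filter (fun u : Fin l => l - b ≤ (u : ℕ)),
        Complex.exp ((π : ℂ) * Complex.I * z / κ) * Complex.sin ((π : ℂ) * s u / κ) /
          Complex.sin ((π : ℂ) * (s u - z + m₂) / κ)) *
    ∏ u, ∏ v ∈ Finset.Ioi u,
      Complex.sin ((π : ℂ) * (s u - s v - 1) / κ) / Complex.sin ((π : ℂ) * (s u - s v) / κ)) t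

/-- The function `Ξ_l(t,z,μ;m₁,m₂)`; the prefactor `(−πκ)^{−l(l+3)/2}` is the principal
power `exp(−(l(l+3)/2)·Log(−πκ))`. -/
noncomputable def XiFun (κ : ℂ) {l : ℕ} (t : Fin l → ℂ) (z μ m₁ m₂ : ℂ) : ℂ :=
  (-(π : ℂ) * κ) ^ (-((l : ℂ) * ((l : ℂ) + 3)) / 2) *
  Complex.exp ((μ - (π : ℂ) * Complex.I) * (∑ u, t u) / κ) *
  (∏ u, Complex.Gamma (t u / κ) * Complex.Gamma (-(m₁ + t u) / κ) *
      Complex.Gamma ((t u - z) / κ) * Complex.Gamma ((z - m₂ - t u) / κ)) *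
  ∏ u, ∏ v ∈ Finset.Ioi u,
    (t u - t v) * Complex.sin ((π : ℂ) * (t u - t v) / κ) *
      Complex.Gamma ((t u - t v + 1) / κ) * Complex.Gamma ((t v - t u + 1) / κ)

/-- The polynomial weight function `p_{l−a,a}(t,z;m₂)`. -/
noncomputable def pWeight {l : ℕ} (a : ℕ) (t : Fin l → ℂ) (z m₂ : ℂ) : ℂ :=
  SymSum (fun s =>
    (∏ u ∈ Finset.univ.filter (fun u : Fin l => (u : ℕ) < l - a), (s u - z + m₂)) *
    (∏ u ∈ Finset.univ.filter (fun u : Fin l => l - a ≤ (u : ℕ)), s u) *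
    ∏ u, ∏ v ∈ Finset.Ioi u, (s u - s v - 1) / (s u - s v)) t

/-- The trigonometric polynomial weight function `P_{l−b,b}(t,z;m₂)`. -/
noncomputable def PWeight (κ : ℂ) {l : ℕ} (b : ℕ) (t : Fin l → ℂ) (z m₂ : ℂ) : ℂ :=
  Complex.exp ((π : ℂ) * Complex.I * (b : ℂ) * z / κ) *
  SymSum (fun s =>
    (∏ u ∈ Finset.univ.filter (fun u : Fin l => (u : ℕ) < l - b),
        Complex.sin ((π : ℂ) * (s u - z + m₂) / κ)) *
    (∏ u ∈ Finset.univ.filter (fun u : Fin l => l - b ≤ (u : ℕ)),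
        Complex.sin ((π : ℂ) * s u / κ)) *
    ∏ u, ∏ v ∈ Finset.Ioi u,
      Complex.sin ((π : ℂ) * (s u - s v - 1) / κ) / Complex.sin ((π : ℂ) * (s u - s v) / κ)) t

/-- Clearing the denominators `h` of a symmetrized product, using that `∏ u, h (t u)` is
symmetric. -/
theorem prod_mul_symSum_div {l : ℕ} (k : ℕ) (g h : ℂ → ℂ) (K : (Fin l → ℂ) → ℂ) (t : Fin l → ℂ)
    (ht : ∀ u, h (t u) ≠ 0) :
    (∏ u, h (t u)) * SymSum (fun s =>
        (∏ u ∈ Finset.univ.filter (fun u : Fin l => k ≤ (u : ℕ)), g (s u) / h (s u)) * K s) t =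
      SymSum (fun s =>
        (∏ u ∈ Finset.univ.filter (fun u : Fin l => (u : ℕ) < k), h (s u)) *
        (∏ u ∈ Finset.univ.filter (fun u : Fin l => k ≤ (u : ℕ)), g (s u)) * K s) t := by
  unfold SymSum
  rw [Finset.mul_sum]
  refine Finset.sum_congr rfl fun σ _ => ?_
  have hprod : ∏ u, h (t u) =
      (∏ u ∈ Finset.univ.filter (fun u : Fin l => (u : ℕ) < k), h ((t ∘ σ) u)) *
      ∏ u ∈ Finset.univ.filter (fun u : Fin l => k ≤ (u : ℕ)), h ((t ∘ σ) u) := by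
    rw [← Equiv.prod_comp σ (fun u => h (t u)),
      ← Finset.prod_filter_mul_prod_filter_not Finset.univ (fun u : Fin l => (u : ℕ) < k)]
    simp only [not_lt, Function.comp_apply]
  have hne : ∏ u ∈ Finset.univ.filter (fun u : Fin l => k ≤ (u : ℕ)), h ((t ∘ σ) u) ≠ 0 :=
    Finset.prod_ne_zero_iff.mpr fun u _ => ht (σ u)
  simp only [hprod, Finset.prod_div_distrib]
  field_simp

/-- A constant factor can be taken out of a symmetrization. -/
theorem symSum_const_mul {l : ℕ} (c : ℂ) (f : (Fin l → ℂ) → ℂ) (t : Fin l → ℂ) :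
    SymSum (fun s => c * f s) t = c * SymSum f t := by
  simp only [SymSum, Finset.mul_sum]

theorem card_filter_sub_le_val {l b : ℕ} (hb : b ≤ l) :
    (Finset.univ.filter (fun u : Fin l => l - b ≤ (u : ℕ))).card = b := by
  have h := Finset.card_filter_add_card_filter_not (s := (Finset.univ : Finset (Fin l)))
    (fun u : Fin l => (u : ℕ) < l - b)
  simp only [not_lt, Finset.card_univ, Fintype.card_fin, Fin.card_filter_val_lt] at h
  omega

theorem two_mul_sum_card_Ioi (l : ℕ) : 2 * ∑ u : Fin l, (Finset.Ioi u).card = l * (l - 1) := by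
  simp only [Fin.card_Ioi]
  rw [Fin.sum_univ_eq_sum_range (fun i => l - 1 - i) l, Finset.sum_range_reflect (fun i => i) l,
    mul_comm, Finset.sum_range_id_mul_two]

/-- The reflection formula in the form `1 / Γ(x) = -x sin(πx) Γ(-x) / π`. -/
theorem Gamma_inv_eq_sin_mul_Gamma_neg {x : ℂ} (hx : ∀ n : ℤ, x ≠ n) :
    (Complex.Gamma x)⁻¹ = -x * Complex.sin (π * x) * Complex.Gamma (-x) / π := by
  have hx0 : -x ≠ 0 := neg_ne_zero.mpr (by simpa using hx 0)
  have hG : Complex.Gamma x ≠ 0 :=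
    Complex.Gamma_ne_zero fun m => by simpa using hx (-(m : ℤ))
  have hs := sin_pi_mul_ne_zero (x := x) (by rintro ⟨n, hn⟩; exact hx n hn.symm)
  have hπ : (π : ℂ) ≠ 0 := Complex.ofReal_ne_zero.mpr Real.pi_ne_zero
  have key := Complex.Gamma_mul_Gamma_one_sub x
  rw [show 1 - x = -x + 1 by ring, Complex.Gamma_add_one _ hx0, eq_div_iff hs] at key
  rw [eq_div_iff hπ, inv_mul_eq_iff_eq_mul₀ hG]
  linear_combination -key

/-- The reflection formula at `y / κ`, for the sine and Gamma factors with period `κ`. -/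
theorem Gamma_div_inv_eq {κ y : ℂ} (hκ : κ ≠ 0) (hy : ∀ n : ℤ, y / κ ≠ n) :
    (Complex.Gamma (y / κ))⁻¹ =
      (-(π : ℂ) * κ)⁻¹ * (y * Complex.sin (π * y / κ) * Complex.Gamma (-y / κ)) := by
  have hπ : (π : ℂ) ≠ 0 := Complex.ofReal_ne_zero.mpr Real.pi_ne_zero
  rw [Gamma_inv_eq_sin_mul_Gamma_neg hy, mul_div_assoc (π : ℂ) y κ, neg_div κ y]
  field_simp

theorem sin_pi_mul_div_ne_zero {κ y : ℂ} (hy : ∀ n : ℤ, y / κ ≠ n) :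
    Complex.sin (π * y / κ) ≠ 0 := by
  rw [mul_div_assoc]
  exact sin_pi_mul_ne_zero (by rintro ⟨n, hn⟩; exact hy n hn.symm)

theorem cpow_neg_half_mul_add_three (c : ℂ) (l : ℕ) :
    c ^ (-((l : ℂ) * ((l : ℂ) + 3)) / 2) =
      (c⁻¹) ^ l * (c⁻¹) ^ l * (c⁻¹) ^ (∑ u : Fin l, (Finset.Ioi u).card) := by
  have hN : 2 * ((∑ u : Fin l, (Finset.Ioi u).card : ℕ) : ℂ) = l * (l - 1) := by
    rcases Nat.eq_zero_or_pos l with rfl | hl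
    · simp
    · have h := congrArg (Nat.cast : ℕ → ℂ) (two_mul_sum_card_Ioi l)
      rwa [Nat.cast_mul, Nat.cast_mul, Nat.cast_sub hl, Nat.cast_ofNat, Nat.cast_one] at h
  rw [← pow_add, ← pow_add, inv_pow, ← Complex.cpow_natCast, ← Complex.cpow_neg]
  congr 1
  rw [Nat.cast_add, Nat.cast_add]
  linear_combination (1 / 2 : ℂ) * hN

theorem mul_ratWeight_eq {l : ℕ} (a : ℕ) (t : Fin l → ℂ) (z m₁ m₂ : ℂ)
    (h : ∀ u, t u - z + m₂ ≠ 0) :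
    (∏ u, (t u - z + m₂)) * ratWeight a t z m₁ m₂ =
      (∏ u, ∏ v ∈ Finset.Ioi u, (t u - t v) / (t u - t v - 1)) * (∏ u, (t u + m₁)⁻¹) *
        pWeight a t z m₂ := by
  unfold ratWeight pWeight
  rw [← prod_mul_symSum_div (l - a) (fun x => x) (fun x => x - z + m₂) _ t h]
  ring

theorem mul_trigWeight_eq (κ : ℂ) {l b : ℕ} (hb : b ≤ l) (t : Fin l → ℂ) (z m₁ m₂ : ℂ)
    (h : ∀ u, Complex.sin ((π : ℂ) * (t u - z + m₂) / κ) ≠ 0) :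
    (∏ u, Complex.sin ((π : ℂ) * (t u - z + m₂) / κ)) * trigWeight κ b t z m₁ m₂ =
      (∏ u, ∏ v ∈ Finset.Ioi u,
        Complex.sin ((π : ℂ) * (t u - t v) / κ) / Complex.sin ((π : ℂ) * (t u - t v - 1) / κ)) *
      (∏ u, Complex.exp (-(π : ℂ) * Complex.I * t u / κ) /
        Complex.sin ((π : ℂ) * (t u + m₁) / κ)) * PWeight κ b t z m₂ := by
  unfold trigWeight PWeight
  have hexp : Complex.exp ((π : ℂ) * Complex.I * (b : ℂ) * z / κ) =
      Complex.exp ((π : ℂ) * Complex.I * z / κ) ^ b := by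
    rw [← Complex.exp_nat_mul]
    ring_nf
  rw [← prod_mul_symSum_div (l - b) (fun x => Complex.sin ((π : ℂ) * x / κ))
    (fun x => Complex.sin ((π : ℂ) * (x - z + m₂) / κ)) _ t h, hexp]
  simp only [mul_div_assoc (Complex.exp _) (Complex.sin _) (Complex.sin _),
    Finset.prod_mul_distrib, Finset.prod_const, card_filter_sub_le_val hb, mul_assoc,
    symSum_const_mul]
  ring

theorem mul_three_pairs_eq {S₁ S₂ S₃ D₁ D₂ D₃ : ℂ} {c₁ c₂ E e G A B H p P : ℂ}
    (hS : S₁ * S₂ * S₃ = c₁ * e * G * A * B) (hD : D₁ * D₂ * D₃ = c₂ * H) :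
    E * S₁ * D₁ * (D₂ * S₂ * p) * (D₃ * S₃ * P) =
      A * B * (c₁ * c₂ * (E * e) * G * H * p * P) := by
  linear_combination E * p * P * (D₁ * D₂ * D₃ * hS + c₁ * e * G * A * B * hD)

/-- The alternative description of the integrand of the q-hypergeometric integral:
`Φ_{l} w_{l−a,a} W_{l−b,b} = Ξ_{l} p_{l−a,a} P_{l−b,b}`. -/
theorem qHypergeometric_integrand_alt
    (κ : ℂ) (hκ : κ ≠ 0) (l : ℕ) (hl : 0 < l) (a b : ℕ) (ha : a ≤ l) (hb : b ≤ l)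
    (t : Fin l → ℂ) (z μ m₁ m₂ : ℂ)
    (h₁ : ∀ u : Fin l, ∀ n : ℤ, (t u + m₁) / κ ≠ (n : ℂ))
    (h₂ : ∀ u : Fin l, ∀ n : ℤ, (t u - z + m₂) / κ ≠ (n : ℂ))
    (h₃ : ∀ u v : Fin l, u ≠ v → ∀ n : ℤ, (t u - t v) / κ ≠ (n : ℂ))
    (h₄ : ∀ u v : Fin l, u ≠ v → ∀ n : ℤ, (t u - t v - 1) / κ ≠ (n : ℂ)) :
    qMaster κ t z μ m₁ m₂ * ratWeight a t z m₁ m₂ * trigWeight κ b t z m₁ m₂ =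
      XiFun κ t z μ m₁ m₂ * pWeight a t z m₂ * PWeight κ b t z m₂ := by
  set c : ℂ := (-(π : ℂ) * κ)⁻¹ with hc
  have h0 : ∀ {y : ℂ}, (∀ n : ℤ, y / κ ≠ n) → y ≠ 0 := fun hy h => by
    simpa [h] using hy 0
  have hsingle : (∏ u, (Complex.Gamma (t u / κ) * Complex.Gamma ((t u - z) / κ)) /
        (Complex.Gamma ((t u + m₁) / κ) * Complex.Gamma ((t u - z + m₂) / κ))) *
        (∏ u, (t u + m₁)⁻¹) *
        (∏ u, Complex.exp (-(π : ℂ) * Complex.I * t u / κ) /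
          Complex.sin ((π : ℂ) * (t u + m₁) / κ)) =
      c ^ l * c ^ l * Complex.exp (-(π : ℂ) * Complex.I * (∑ u, t u) / κ) *
        (∏ u, Complex.Gamma (t u / κ) * Complex.Gamma (-(m₁ + t u) / κ) *
          Complex.Gamma ((t u - z) / κ) * Complex.Gamma ((z - m₂ - t u) / κ)) *
        (∏ u, (t u - z + m₂)) * ∏ u, Complex.sin ((π : ℂ) * (t u - z + m₂) / κ) := by
    have hconst : c ^ l = ∏ _u : Fin l, c := by simp
    rw [hconst, Finset.mul_sum, Finset.sum_div, Complex.exp_sum]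
    simp only [← Finset.prod_mul_distrib]
    refine Finset.prod_congr rfl fun u _ => ?_
    have hs := sin_pi_mul_div_ne_zero (h₁ u)
    have hm := h0 (h₁ u)
    rw [div_eq_mul_inv (_ * _) (_ * _), mul_inv, Gamma_div_inv_eq hκ (h₁ u),
      Gamma_div_inv_eq hκ (h₂ u), ← hc, show -(t u + m₁) = -(m₁ + t u) by ring,
      show -(t u - z + m₂) = z - m₂ - t u by ring]
    generalize Complex.sin ((π : ℂ) * (t u + m₁) / κ) = s at hs ⊢
    generalize Complex.sin ((π : ℂ) * (t u - z + m₂) / κ) = s'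
    generalize Complex.exp (-(π : ℂ) * Complex.I * t u / κ) = e
    generalize Complex.Gamma (-(m₁ + t u) / κ) = G₁
    generalize Complex.Gamma ((z - m₂ - t u) / κ) = G₂
    generalize Complex.Gamma (t u / κ) = G₃
    generalize Complex.Gamma ((t u - z) / κ) = G₄
    clear_value c
    field_simp
  have hpair : (∏ u, ∏ v ∈ Finset.Ioi u,
          Complex.Gamma ((t u - t v + 1) / κ) / Complex.Gamma ((t u - t v - 1) / κ)) *
        (∏ u, ∏ v ∈ Finset.Ioi u, (t u - t v) / (t u - t v - 1)) *
        (∏ u, ∏ v ∈ Finset.Ioi u, Complex.sin ((π : ℂ) * (t u - t v) / κ) /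
          Complex.sin ((π : ℂ) * (t u - t v - 1) / κ)) =
      c ^ (∑ u : Fin l, (Finset.Ioi u).card) * ∏ u, ∏ v ∈ Finset.Ioi u,
        (t u - t v) * Complex.sin ((π : ℂ) * (t u - t v) / κ) *
          Complex.Gamma ((t u - t v + 1) / κ) * Complex.Gamma ((t v - t u + 1) / κ) := by
    have hconst : c ^ (∑ u : Fin l, (Finset.Ioi u).card) =
        ∏ u : Fin l, ∏ _v ∈ Finset.Ioi u, c := by
      simp only [Finset.prod_const, Finset.prod_pow_eq_pow_sum]
    rw [hconst]
    simp only [← Finset.prod_mul_distrib]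
    refine Finset.prod_congr rfl fun u _ => Finset.prod_congr rfl fun v hv => ?_
    have hy := h₄ u v (Finset.mem_Ioi.mp hv).ne
    have hs := sin_pi_mul_div_ne_zero hy
    have hm := h0 hy
    rw [div_eq_mul_inv (Complex.Gamma _) (Complex.Gamma _), Gamma_div_inv_eq hκ hy, ← hc,
      show -(t u - t v - 1) = t v - t u + 1 by ring]
    generalize Complex.sin ((π : ℂ) * (t u - t v - 1) / κ) = s at hs ⊢
    generalize Complex.sin ((π : ℂ) * (t u - t v) / κ) = s'
    generalize Complex.Gamma ((t u - t v + 1) / κ) = G₁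
    generalize Complex.Gamma ((t v - t u + 1) / κ) = G₂
    clear_value c
    field_simp
  have hexp : Complex.exp ((μ - (π : ℂ) * Complex.I) * (∑ u, t u) / κ) =
      Complex.exp (μ * (∑ u, t u) / κ) *
        Complex.exp (-(π : ℂ) * Complex.I * (∑ u, t u) / κ) := by
    rw [← Complex.exp_add]
    ring_nf
  have hden : ∀ u, t u - z + m₂ ≠ 0 := fun u => h0 (h₂ u)
  have hsin : ∀ u, Complex.sin ((π : ℂ) * (t u - z + m₂) / κ) ≠ 0 := fun u =>
    sin_pi_mul_div_ne_zero (h₂ u)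
  have hrat := mul_ratWeight_eq a t z m₁ m₂ hden
  have htrig := mul_trigWeight_eq κ hb t z m₁ m₂ hsin
  have hA : ∏ u, (t u - z + m₂) ≠ 0 := Finset.prod_ne_zero_iff.mpr fun u _ => hden u
  have hB : ∏ u, Complex.sin ((π : ℂ) * (t u - z + m₂) / κ) ≠ 0 :=
    Finset.prod_ne_zero_iff.mpr fun u _ => hsin u
  refine mul_left_cancel₀ (mul_ne_zero hA hB) ?_
  calc _ = qMaster κ t z μ m₁ m₂ * ((∏ u, (t u - z + m₂)) * ratWeight a t z m₁ m₂) *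
        ((∏ u, Complex.sin ((π : ℂ) * (t u - z + m₂) / κ)) * trigWeight κ b t z m₁ m₂) := by
        ring
    _ = _ := by
        rw [hrat, htrig, qMaster, XiFun, cpow_neg_half_mul_add_three, ← hc, hexp]
        generalize pWeight a t z m₂ = p
        generalize PWeight κ b t z m₂ = P
        exact mul_three_pairs_eq hsingle hpair
end

section
/- Let l be a positive integer and a an integer with 0 ≤ a ≤ l. Then there exists a (necessarily unique) polynomial q in the l+2 variables t₁,…,t_l, z, m with complex coefficients such that for all complex numbers t₁,…,t_l, z, m with t_u ≠ t_v for all u ≠ v, one has Sym[ ∏_{u=1}^{l−a} (t_u−z+m) · ∏_{u=l−a+1}^{l} t_u · ∏_{1≤u<v≤l} (t_u−t_v−1)/(t_u−t_v) ] = q(t₁,…,t_l,z,m). (That is, the function p_{l−a,a}(t,z;m) is a polynomial in t₁,…,t_l, z, m.) -/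
open Complex Finset

namespace MvPolynomial

section

variable {τ R : Type*} [CommRing R] [DecidableEq τ]

theorem X_sub_X_dvd_sub_rename (i j : τ) (p : MvPolynomial τ R) :
    X i - X j ∣ p - rename (Function.update id i j) p := by
  induction p using MvPolynomial.induction_on with
  | C r => simp
  | add p q hp hq =>
    rw [map_add, add_sub_add_comm]
    exact dvd_add hp hq
  | mul_X p k hp =>
    have hk : (X i - X j : MvPolynomial τ R) ∣ X k - X (Function.update id i j k) := by
      by_cases h : k = i
      · subst h; simp
      · simp [h]
    rw [map_mul, rename_X]
    convert dvd_add (hp.mul_right (X k))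
      (hk.mul_left (rename (Function.update id i j) p)) using 1
    ring

theorem X_sub_X_dvd_iff (i j : τ) (p : MvPolynomial τ R) :
    X i - X j ∣ p ↔ rename (Function.update id i j) p = 0 := by
  constructor
  · rintro ⟨q, rfl⟩
    by_cases h : j = i
    · simp [h]
    · simp [h]
  · intro h
    simpa [h] using X_sub_X_dvd_sub_rename i j p

theorem prime_X_sub_X [IsDomain R] {i j : τ} (h : i ≠ j) :
    Prime (X i - X j : MvPolynomial τ R) := by
  refine ⟨sub_ne_zero.2 fun h' => h (X_injective h'), fun hu => ?_, fun p q => ?_⟩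
  · simpa using (X_sub_X_dvd_iff i j 1).1 hu.dvd
  · simp only [X_sub_X_dvd_iff, map_mul, mul_eq_zero, imp_self]

theorem X_sub_X_dvd_of_rename_swap_eq_neg [IsDomain R] [CharZero R] {i j : τ}
    {p : MvPolynomial τ R} (hp : rename (Equiv.swap i j) p = -p) : X i - X j ∣ p := by
  rw [X_sub_X_dvd_iff, ← self_eq_neg, ← map_neg, ← hp, rename_rename]
  congr 2
  funext k
  by_cases hi : k = i
  · subst hi
    by_cases hj : j = k <;> simp [hj]
  · by_cases hj : k = j
    · subst hj; simp [hi]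
    · simp [Equiv.swap_apply_of_ne_of_ne hi hj]

theorem prod_X_sub_X_dvd [IsDomain R] [UniqueFactorizationMonoid R] {l : ℕ} {e : Fin l → τ}
    (he : Function.Injective e)
    {p : MvPolynomial τ R} (hp : ∀ i j, i < j → X (e i) - X (e j) ∣ p) :
    ∏ i, ∏ j ∈ Finset.Ioi i, (X (e i) - X (e j)) ∣ p := by
  rw [Finset.prod_sigma']
  refine Finset.prod_dvd_of_isRelPrime ?_ ?_
  · rintro ⟨i, j⟩ hij ⟨i', j'⟩ hij' hne
    simp only [Finset.coe_sigma, Set.mem_sigma_iff, Finset.mem_coe, Finset.mem_univ,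
      Finset.mem_Ioi, true_and] at hij hij'
    refine (prime_X_sub_X (he.ne hij.ne)).irreducible.isRelPrime_iff_not_dvd.2 ?_
    rw [X_sub_X_dvd_iff, map_sub, rename_X, rename_X, sub_eq_zero, (X_injective (R := R)).eq_iff]
    simp only [Function.update_apply, id, he.eq_iff]
    intro h
    apply hne
    split_ifs at h <;> simp_all [he.eq_iff] <;> omega
  · rintro ⟨i, j⟩ hij
    exact hp i j (by simpa using hij)

end

section

variable {l : ℕ} {κ R : Type*} [CommRing R]

/-- The antisymmetrization of a polynomial over the first group of variables. -/
noncomputable def antisymmetrize (p : MvPolynomial (Fin l ⊕ κ) R) : MvPolynomial (Fin l ⊕ κ) R :=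
  ∑ σ : Equiv.Perm (Fin l), ((σ.sign : ℤ) : MvPolynomial (Fin l ⊕ κ) R) * rename (Sum.map σ id) p

theorem rename_antisymmetrize (π : Equiv.Perm (Fin l)) (p : MvPolynomial (Fin l ⊕ κ) R) :
    rename (Sum.map π id) (antisymmetrize p) = ((π.sign : ℤ) : MvPolynomial _ R) *
      antisymmetrize p := by
  unfold antisymmetrize
  rw [map_sum, Finset.mul_sum]
  refine Fintype.sum_equiv (Equiv.mulLeft π) _ _ fun σ => ?_
  have h : ((π.sign : ℤ) : MvPolynomial (Fin l ⊕ κ) R) * ((π.sign : ℤ) : MvPolynomial _ R) = 1 := by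
    rw [← Int.cast_mul, ← Units.val_mul, Int.units_mul_self]; simp
  rw [map_mul, map_intCast, rename_rename, Sum.map_comp_map, Equiv.coe_mulLeft,
    Equiv.Perm.sign_mul, Units.val_mul, Int.cast_mul, Equiv.Perm.coe_mul, Function.id_comp]
  rw [← mul_assoc, ← mul_assoc, h, one_mul]

theorem prod_X_sub_X_dvd_antisymmetrize [IsDomain R] [UniqueFactorizationMonoid R] [CharZero R]
    (p : MvPolynomial (Fin l ⊕ κ) R) :
    ∏ i : Fin l, ∏ j ∈ Finset.Ioi i, (X (Sum.inl i) - X (Sum.inl j)) ∣ antisymmetrize p := by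
  classical
  refine prod_X_sub_X_dvd Sum.inl_injective fun i j hij => ?_
  apply X_sub_X_dvd_of_rename_swap_eq_neg
  rw [← Equiv.Perm.sumCongr_swap_refl, Equiv.Perm.sumCongr]
  refine (rename_antisymmetrize _ p).trans ?_
  simp [Equiv.Perm.sign_swap hij.ne]

theorem eval_antisymmetrize (p : MvPolynomial (Fin l ⊕ κ) R) (t : Fin l → R) (w : κ → R) :
    eval (Sum.elim t w) (antisymmetrize p) =
      ∑ σ : Equiv.Perm (Fin l), ((σ.sign : ℤ) : R) * eval (Sum.elim (t ∘ σ) w) p := by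
  simp [antisymmetrize, map_sum, eval_rename, Sum.elim_comp_map]

end

end MvPolynomial

theorem prod_sub_comp_perm {R : Type*} [CommRing R] {l : ℕ} (t : Fin l → R)
    (σ : Equiv.Perm (Fin l)) :
    ∏ i, ∏ j ∈ Finset.Ioi i, (t (σ i) - t (σ j)) =
      ((σ.sign : ℤ) : R) * ∏ i, ∏ j ∈ Finset.Ioi i, (t i - t j) := by
  have h := Matrix.det_permute σ (Matrix.vandermonde fun i => -t i)
  have h' : (Matrix.vandermonde fun i => -t i).submatrix σ id =
      Matrix.vandermonde fun i => -t (σ i) := rfl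
  rw [h', Matrix.det_vandermonde, Matrix.det_vandermonde] at h
  simpa only [neg_sub_neg] using h

theorem prod_sub_ne_zero {R : Type*} [CommRing R] [IsDomain R] {l : ℕ} {t : Fin l → R} :
    ∏ i, ∏ j ∈ Finset.Ioi i, (t i - t j) ≠ 0 ↔ ∀ u v : Fin l, u ≠ v → t u ≠ t v := by
  simp only [Finset.prod_ne_zero_iff, Finset.mem_univ, true_imp_iff, Finset.mem_Ioi, sub_ne_zero]
  refine ⟨fun h u v huv => ?_, fun h u v huv => h u v huv.ne⟩
  rcases huv.lt_or_gt with huv | huv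
  · exact h u v huv
  · exact (h v u huv).symm

theorem MvPolynomial.eq_of_eval_eq_of_pairwise_ne {R κ : Type*} [CommRing R] [IsDomain R]
    [Infinite R] {l : ℕ} {p q : MvPolynomial (Fin l ⊕ κ) R}
    (h : ∀ (t : Fin l → R) (w : κ → R), (∀ u v : Fin l, u ≠ v → t u ≠ t v) →
      eval (Sum.elim t w) p = eval (Sum.elim t w) q) : p = q := by
  have hD : (∏ i : Fin l, ∏ j ∈ Finset.Ioi i, (X (Sum.inl i) - X (Sum.inl j)) :
      MvPolynomial (Fin l ⊕ κ) R) ≠ 0 :=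
    prod_sub_ne_zero.2 fun u v huv => (X_injective.comp Sum.inl_injective).ne huv
  refine mul_left_cancel₀ hD (MvPolynomial.funext fun x => ?_)
  rw [map_mul, map_mul]
  by_cases hx : ∀ u v : Fin l, u ≠ v → x (Sum.inl u) ≠ x (Sum.inl v)
  · have := h (x ∘ Sum.inl) (x ∘ Sum.inr) hx
    rw [Sum.elim_comp_inl_inr] at this
    rw [this]
  · rw [← prod_sub_ne_zero (t := fun u => x (Sum.inl u)), not_not] at hx
    simp [map_prod, hx]

/-- The function
`p_{l−a,a}(t,z;m) = Sym[ ∏_{u=1}^{l−a} (t_u−z+m) ∏_{u=l−a+1}^{l} t_u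
  ∏_{1≤u<v≤l} (t_u−t_v−1)/(t_u−t_v) ]`
is given, wherever the `t_u` are pairwise distinct, by a (necessarily unique) polynomial
in the `l+2` variables `t₁,…,t_l, z, m`. -/
theorem pWeight_is_polynomial (l : ℕ) (hl : 0 < l) (a : ℕ) (ha : a ≤ l) :
    ∃! q : MvPolynomial (Fin l ⊕ Fin 2) ℂ,
      ∀ (t : Fin l → ℂ) (z m : ℂ), (∀ u v : Fin l, u ≠ v → t u ≠ t v) →
        SymSum (fun s =>
          (∏ u ∈ Finset.univ.filter (fun u : Fin l => (u : ℕ) < l - a), (s u - z + m)) *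
          (∏ u ∈ Finset.univ.filter (fun u : Fin l => l - a ≤ (u : ℕ)), s u) *
          ∏ u, ∏ v ∈ Finset.Ioi u, (s u - s v - 1) / (s u - s v)) t =
        MvPolynomial.eval (Sum.elim t ![z, m]) q := by
  classical
  let N : MvPolynomial (Fin l ⊕ Fin 2) ℂ :=
    (∏ u ∈ Finset.univ.filter (fun u : Fin l => (u : ℕ) < l - a),
      (MvPolynomial.X (Sum.inl u) - MvPolynomial.X (Sum.inr 0) + MvPolynomial.X (Sum.inr 1))) *
    (∏ u ∈ Finset.univ.filter (fun u : Fin l => l - a ≤ (u : ℕ)), MvPolynomial.X (Sum.inl u)) *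
    ∏ u : Fin l, ∏ v ∈ Finset.Ioi u, (MvPolynomial.X (Sum.inl u) - MvPolynomial.X (Sum.inl v) - 1)
  obtain ⟨q, hq⟩ := MvPolynomial.prod_X_sub_X_dvd_antisymmetrize N
  refine existsUnique_of_exists_of_unique ⟨q, fun t z m ht => ?_⟩ fun p₁ p₂ h₁ h₂ => ?_
  · have hD := prod_sub_ne_zero.2 ht
    have hqt := congrArg (MvPolynomial.eval (Sum.elim t ![z, m])) hq
    rw [MvPolynomial.eval_antisymmetrize, map_mul] at hqt
    simp only [map_prod, map_sub, MvPolynomial.eval_X, Sum.elim_inl] at hqt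
    refine mul_left_cancel₀ hD (Eq.trans ?_ hqt)
    rw [SymSum, Finset.mul_sum]
    refine Finset.sum_congr rfl fun σ _ => ?_
    have hσ := prod_sub_comp_perm t σ
    have hs : ((σ.sign : ℤ) : ℂ) * ((σ.sign : ℤ) : ℂ) = 1 := by
      rw [← Int.cast_mul, ← Units.val_mul, Int.units_mul_self]; simp
    have hs0 : ((σ.sign : ℤ) : ℂ) ≠ 0 := left_ne_zero_of_mul_eq_one hs
    simp only [N, map_mul, map_prod, map_sub, map_add, map_one, MvPolynomial.eval_X, Sum.elim_inl,
      Sum.elim_inr, Finset.prod_div_distrib, Function.comp_apply, hσ, Matrix.cons_val_zero,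
      Matrix.cons_val_one]
    rw [mul_div_assoc', mul_div_assoc', div_eq_iff (mul_ne_zero hs0 hD)]
    rw [mul_mul_mul_comm, hs, one_mul, mul_comm]
  · refine MvPolynomial.eq_of_eval_eq_of_pairwise_ne fun t w ht => ?_
    have hw : w = ![w 0, w 1] := by
      ext i; fin_cases i <;> rfl
    rw [hw, ← h₁ t _ _ ht, h₂ t _ _ ht]
end
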